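/- (Vitali-type measure dichotomy) Let μ ∈ (0,1) and let E ⊂ F ⊂ B_1 × ℝ ⊂ ℝ^d × ℝ be open sets for the parabolic metric d_α((x_0,t_0),(x_1,t_1)) = max((2|t_0-t_1|)^{1/α}, |x_0-x_1|) with α ∈ (0,2]. Suppose: (i) for every point (x,t) ∈ F there exists a parabolic cylinder Q ⊂ B_1 × ℝ (a d_α-ball) with (x,t) ∈ Q and |E ∩ Q| ≤ (1-μ)|Q|; and (ii) for every parabolic cylinder Q ⊂ B_1 × ℝ with |E ∩ Q| > (1-μ)|Q|, one has Q ⊂ F. Then |E| ≤ (1 - 5^{-d-α} μ) |F|. -/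

import Mathlib

open MeasureTheory Metric Set

/-- The parabolic cylinder `Q_r(x,t) = B_r(x) × (t - r^α, t]`, a ball for the parabolic
metric `d_α((x₀,t₀),(x₁,t₁)) = max((2|t₀-t₁|)^{1/α}, |x₀-x₁|)`. -/
noncomputable def pcyl (d : ℕ) (α : ℝ) (x : EuclideanSpace ℝ (Fin d)) (t r : ℝ) :
    Set (EuclideanSpace ℝ (Fin d) × ℝ) :=
  (ball x r) ×ˢ (Ioc (t - r ^ α) t)


/-- Irredundant finite families of intervals can be two-coloured into disjoint families. -/
lemma interval_coloring {ι : Type*} [DecidableEq ι] (a b : ι → ℝ) (N : Finset ι)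
    (hirr : ∀ i ∈ N, ¬ (Ioo (a i) (b i) ⊆ ⋃ j ∈ N.erase i, Ioo (a j) (b j))) :
    ∃ col : ι → Bool, ∀ i ∈ N, ∀ j ∈ N, i ≠ j → col i = col j →
      Disjoint (Ioo (a i) (b i)) (Ioo (a j) (b j)) := by
  induction N using Finset.strongInduction with
  | H N ih =>
  rcases N.eq_empty_or_nonempty with rfl | hne
  · exact ⟨fun _ => true, by simp⟩
  obtain ⟨i, hi, hmax⟩ := N.exists_max_image a hne
  have hss : N.erase i ⊂ N := Finset.erase_ssubset hi
  obtain ⟨col, hcol⟩ := ih (N.erase i) hss (by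
    intro j hj hsub
    refine hirr j (Finset.mem_of_mem_erase hj) (hsub.trans ?_)
    intro x hx
    simp only [mem_iUnion, exists_prop, Finset.mem_erase] at hx ⊢
    obtain ⟨k, hk, hx⟩ := hx
    exact ⟨k, ⟨hk.1, hk.2.2⟩, hx⟩)
  -- no containments
  have key : ∀ j ∈ N.erase i, ∀ k ∈ N.erase i, j ≠ k → a j ≤ a k →
      ¬ Disjoint (Ioo (a i) (b i)) (Ioo (a j) (b j)) → False := by
    intro j hj k hk hjk hle hd
    have hjN := Finset.mem_of_mem_erase hj
    have hkN := Finset.mem_of_mem_erase hk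
    have hki : k ≠ i := Finset.ne_of_mem_erase hk
    have hji : j ≠ i := Finset.ne_of_mem_erase hj
    rw [Set.not_disjoint_iff] at hd
    obtain ⟨y, hy1, hy2⟩ := hd
    apply hirr k hkN
    intro x hx
    simp only [mem_iUnion, exists_prop, Finset.mem_erase]
    have hbk : b k ≤ b i := by
      by_contra hcon
      push Not at hcon
      apply hirr i hi
      intro z hz
      simp only [mem_iUnion, exists_prop]
      exact ⟨k, hk, lt_of_le_of_lt (hmax k hkN) hz.1, hz.2.trans hcon⟩
    by_cases hxb : x < b j
    · exact ⟨j, ⟨hjk, hjN⟩, lt_of_le_of_lt hle hx.1, hxb⟩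
    · push Not at hxb
      exact ⟨i, ⟨hki.symm, hi⟩, (hy1.1.trans hy2.2).trans_le hxb, hx.2.trans_le hbk⟩
  have uniq : ∀ j ∈ N.erase i, ∀ k ∈ N.erase i,
      ¬ Disjoint (Ioo (a i) (b i)) (Ioo (a j) (b j)) →
      ¬ Disjoint (Ioo (a i) (b i)) (Ioo (a k) (b k)) → j = k := by
    intro j hj k hk h1 h2
    by_contra hjk
    rcases le_total (a j) (a k) with h | h
    · exact key j hj k hk hjk h h1
    · exact key k hk j hj (Ne.symm hjk) h h2
  have main : ∃ v : Bool, ∀ j ∈ N.erase i, col j = v →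
      Disjoint (Ioo (a i) (b i)) (Ioo (a j) (b j)) := by
    by_cases hex : ∃ k ∈ N.erase i, ¬ Disjoint (Ioo (a i) (b i)) (Ioo (a k) (b k))
    · obtain ⟨k, hk, hkd⟩ := hex
      refine ⟨!(col k), fun j hj hc => ?_⟩
      by_contra hd
      have := uniq j hj k hk hd hkd
      subst this
      simp at hc
    · push Not at hex
      exact ⟨true, fun j hj _ => hex j hj⟩
  obtain ⟨v, hv⟩ := main
  refine ⟨Function.update col i v, ?_⟩
  intro j hj k hk hjk hc
  by_cases hji : j = i
  · subst hji
    have hk' : k ∈ N.erase j := Finset.mem_erase.2 ⟨hjk.symm, hk⟩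
    rw [Function.update_self, Function.update_of_ne hjk.symm] at hc
    exact hv k hk' hc.symm
  · have hj' : j ∈ N.erase i := Finset.mem_erase.2 ⟨hji, hj⟩
    by_cases hki : k = i
    · subst hki
      rw [Function.update_self, Function.update_of_ne hjk] at hc
      exact (hv j hj' hc).symm
    · rw [Function.update_of_ne hji, Function.update_of_ne hki] at hc
      exact hcol j hj' k (Finset.mem_erase.2 ⟨hki, hk⟩) hjk hc

lemma interval_irr {ι : Type*} [DecidableEq ι] (B : ι → Set ℝ) (M : Finset ι) :
    ∃ N ⊆ M, (⋃ i ∈ N, B i) = (⋃ i ∈ M, B i) ∧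
      ∀ i ∈ N, ¬ (B i ⊆ ⋃ j ∈ N.erase i, B j) := by
  induction M using Finset.strongInduction with
  | H M ih =>
  by_cases h : ∀ i ∈ M, ¬ (B i ⊆ ⋃ j ∈ M.erase i, B j)
  · exact ⟨M, subset_rfl, rfl, h⟩
  · push Not at h
    obtain ⟨i, hi, hsub⟩ := h
    obtain ⟨N, hN, hU, hirr⟩ := ih (M.erase i) (Finset.erase_ssubset hi)
    refine ⟨N, hN.trans (Finset.erase_subset _ _), ?_, hirr⟩
    rw [hU]
    apply subset_antisymm
    · exact biUnion_subset_biUnion_left (fun j hj => Finset.mem_of_mem_erase hj)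
    · refine iUnion₂_subset fun j hj => ?_
      by_cases hji : j = i
      · subst hji; exact hsub
      · exact subset_biUnion_of_mem (u := B) (s := (↑(M.erase i) : Set ι)) (x := j)
          (by simp [hji, hj])

/-- One-dimensional covering lemma with constant `2`. -/
lemma interval_half {ι : Type*} [DecidableEq ι] (a b : ι → ℝ) (M : Finset ι) :
    ∃ sel ⊆ M, (sel : Set ι).PairwiseDisjoint (fun i => Ioo (a i) (b i)) ∧
      volume (⋃ i ∈ M, Ioo (a i) (b i)) ≤ 2 * ∑ i ∈ sel, volume (Ioo (a i) (b i)) := by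
  obtain ⟨N, hN, hU, hirr⟩ := interval_irr (fun i => Ioo (a i) (b i)) M
  obtain ⟨col, hcol⟩ := interval_coloring a b N hirr
  have hdis : ∀ v : Bool, ((N.filter (fun i => col i = v) : Finset ι) : Set ι).PairwiseDisjoint
      (fun i => Ioo (a i) (b i)) := by
    intro v i hi j hj hij
    simp only [Finset.coe_filter, mem_ofPred_eq] at hi hj
    exact hcol i hi.1 j hj.1 hij (hi.2.trans hj.2.symm)
  have hsum : volume (⋃ i ∈ M, Ioo (a i) (b i)) ≤
      ∑ i ∈ N.filter (fun i => col i = true), volume (Ioo (a i) (b i)) +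
      ∑ i ∈ N.filter (fun i => col i = false), volume (Ioo (a i) (b i)) := by
    rw [← hU]
    refine (measure_biUnion_finset_le _ _).trans (le_of_eq ?_)
    rw [← Finset.sum_filter_add_sum_filter_not N (fun i => col i = true)]
    simp
  rcases le_total (∑ i ∈ N.filter (fun i => col i = true), volume (Ioo (a i) (b i)))
      (∑ i ∈ N.filter (fun i => col i = false), volume (Ioo (a i) (b i))) with h | h
  · refine ⟨_, (Finset.filter_subset _ _).trans hN, hdis false, hsum.trans ?_⟩
    rw [two_mul]; gcongr
  · refine ⟨_, (Finset.filter_subset _ _).trans hN, hdis true, hsum.trans ?_⟩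
    rw [two_mul]; gcongr

/-- Connected families. -/
lemma interval_connected {ι : Type*} [DecidableEq ι] (c r : ι → ℝ) (C : Finset ι)
    (hr : ∀ i ∈ C, 0 < r i) (hne : C.Nonempty)
    (hconn : IsPreconnected (⋃ i ∈ C, Ioo (c i - r i) (c i + r i))) :
    ∃ sel ⊆ C, (sel : Set ι).PairwiseDisjoint (fun i => Ioo (c i - r i) (c i + r i)) ∧
      volume (⋃ i ∈ C, Ioo (c i - 3/2 * r i) (c i + 3/2 * r i)) ≤
        ENNReal.ofReal (5/2) * ∑ i ∈ sel, volume (Ioo (c i - r i) (c i + r i)) := by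
  obtain ⟨p, hp, hpm⟩ := C.exists_min_image (fun i => c i - r i) hne
  obtain ⟨q, hq, hqm⟩ := C.exists_max_image (fun i => c i + r i) hne
  obtain ⟨m, hm, hmm⟩ := C.exists_max_image r hne
  have hord := hconn.ordConnected
  set A := c p - r p with hA
  set D := c q + r q with hD
  have hsubU : Ioo A D ⊆ ⋃ i ∈ C, Ioo (c i - r i) (c i + r i) := by
    intro x hx
    have hmem : ∀ i ∈ C, ∀ y, y ∈ Ioo (c i - r i) (c i + r i) →
      y ∈ ⋃ i ∈ C, Ioo (c i - r i) (c i + r i) := fun i hi y hy => by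
        simp only [mem_iUnion, exists_prop]; exact ⟨i, hi, hy⟩
    have hrp := hr p hp
    have hrq := hr q hq
    by_cases h1 : x ≤ c p
    · exact hmem p hp x ⟨hx.1, by linarith⟩
    by_cases h2 : c q ≤ x
    · exact hmem q hq x ⟨by linarith, hx.2⟩
    push Not at h1 h2
    exact hord.out (hmem p hp (c p) ⟨by linarith, by linarith⟩)
      (hmem q hq (c q) ⟨by linarith, by linarith⟩) ⟨h1.le, h2.le⟩
  obtain ⟨s1, hs1, hd1, hv1⟩ := interval_half (fun i => c i - r i) (fun i => c i + r i) C
  have hvol : ∀ s : Finset ι, s ⊆ C → ∑ i ∈ s, volume (Ioo (c i - r i) (c i + r i))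
      = ENNReal.ofReal (∑ i ∈ s, 2 * r i) := by
    intro s hs
    rw [ENNReal.ofReal_sum_of_nonneg (fun i hi => by have := hr i (hs hi); linarith)]
    refine Finset.sum_congr rfl fun i _ => ?_
    rw [Real.volume_Ioo]; congr 1; ring
  have hS1nn : 0 ≤ ∑ i ∈ s1, 2 * r i :=
    Finset.sum_nonneg fun i hi => by have := hr i (hs1 hi); linarith
  have hlen : D - A ≤ 2 * ∑ i ∈ s1, 2 * r i := by
    have h := (measure_mono (μ := volume) hsubU).trans hv1
    rw [hvol s1 hs1, Real.volume_Ioo, ← ENNReal.ofReal_ofNat 2,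
      ← ENNReal.ofReal_mul (by norm_num)] at h
    exact (ENNReal.ofReal_le_ofReal_iff (by positivity)).1 h
  have hrm := hr m hm
  have hbig : volume (⋃ i ∈ C, Ioo (c i - 3/2 * r i) (c i + 3/2 * r i)) ≤
      ENNReal.ofReal ((D - A) + r m) := by
    have hsub : (⋃ i ∈ C, Ioo (c i - 3/2 * r i) (c i + 3/2 * r i)) ⊆
        Ioo (A - r m / 2) (D + r m / 2) := by
      refine iUnion₂_subset fun i hi x hx => ?_
      have h1 := hpm i hi
      have h2 := hqm i hi
      have h3 := hmm i hi
      exact ⟨by have := hx.1; linarith, by have := hx.2; linarith⟩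
    refine (measure_mono hsub).trans (le_of_eq ?_)
    rw [Real.volume_Ioo]; congr 1; ring
  rcases le_total (2 * r m) (∑ i ∈ s1, 2 * r i) with h | h
  · refine ⟨s1, hs1, hd1, hbig.trans ?_⟩
    rw [hvol s1 hs1, ← ENNReal.ofReal_mul (by norm_num)]
    apply ENNReal.ofReal_le_ofReal
    linarith
  · refine ⟨{m}, by simpa using hm, by simp, hbig.trans ?_⟩
    rw [hvol {m} (by simpa using hm), ← ENNReal.ofReal_mul (by norm_num)]
    apply ENNReal.ofReal_le_ofReal
    simp only [Finset.sum_singleton]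
    linarith

lemma interval_slice {ι : Type*} [DecidableEq ι] (c r : ι → ℝ) (M : Finset ι)
    (hr : ∀ i ∈ M, 0 < r i) :
    ∃ sel ⊆ M, (sel : Set ι).PairwiseDisjoint (fun i => Ioo (c i - r i) (c i + r i)) ∧
      volume (⋃ i ∈ M, Ioo (c i - 3/2 * r i) (c i + 3/2 * r i)) ≤
        ENNReal.ofReal (5/2) * ∑ i ∈ sel, volume (Ioo (c i - r i) (c i + r i)) := by
  classical
  induction M using Finset.strongInduction with
  | H M ih =>
  rcases M.eq_empty_or_nonempty with rfl | ⟨i0, hi0⟩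
  · exact ⟨∅, by simp⟩
  let B : ι → Set ℝ := fun i => Ioo (c i - r i) (c i + r i)
  let R : ι → ι → Prop := fun i j => (B i ∩ B j).Nonempty ∧ i ∈ M ∧ j ∈ M
  have hRsymm : Std.Symm R := ⟨fun i j h => ⟨by rw [inter_comm]; exact h.1, h.2.2, h.2.1⟩⟩
  let C := M.filter (fun j => Relation.ReflTransGen R i0 j)
  have hCM : C ⊆ M := Finset.filter_subset _ _
  have hi0C : i0 ∈ C := Finset.mem_filter.2 ⟨hi0, Relation.ReflTransGen.refl⟩
  have hss : M \ C ⊂ M := Finset.sdiff_ssubset hCM ⟨i0, hi0C⟩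
  have hconn : IsPreconnected (⋃ i ∈ C, B i) := by
    have := IsPreconnected.biUnion_of_reflTransGen (t := (C : Set ι)) (s := B)
      (fun i _ => isPreconnected_Ioo) (by
        have base : ∀ j, Relation.ReflTransGen R i0 j →
            Relation.ReflTransGen (fun i j => (B i ∩ B j).Nonempty ∧ i ∈ (C : Set ι)) i0 j ∧
            Relation.ReflTransGen (fun i j => (B i ∩ B j).Nonempty ∧ i ∈ (C : Set ι)) j i0 := by
          intro j hj
          induction hj with
          | refl => exact ⟨.refl, .refl⟩
          | @tail k l hk hkl ihk =>
            have hkC : k ∈ C := Finset.mem_filter.2 ⟨hkl.2.1, hk⟩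
            have hlC : l ∈ C := Finset.mem_filter.2 ⟨hkl.2.2, hk.tail hkl⟩
            refine ⟨ihk.1.tail ⟨hkl.1, hkC⟩, ihk.2.head ⟨?_, hlC⟩⟩
            rw [inter_comm]; exact hkl.1
        intro i hi j hj
        exact (base i (Finset.mem_filter.1 hi).2).2.trans (base j (Finset.mem_filter.1 hj).2).1)
    simpa using this
  obtain ⟨s1, hs1, hd1, hv1⟩ := interval_connected c r C (fun i hi => hr i (hCM hi)) ⟨i0, hi0C⟩ hconn
  obtain ⟨s2, hs2, hd2, hv2⟩ := ih (M \ C) hss (fun i hi => hr i (hss.1 hi))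
  have hcross : ∀ i ∈ C, ∀ j ∈ M \ C, Disjoint (B i) (B j) := by
    intro i hi j hj
    rw [Set.disjoint_iff_inter_eq_empty]
    by_contra hne
    rw [← Ne, ← nonempty_iff_ne_empty] at hne
    obtain ⟨hjM, hjC⟩ := Finset.mem_sdiff.1 hj
    exact hjC (Finset.mem_filter.2 ⟨hjM, (Finset.mem_filter.1 hi).2.tail ⟨hne, hCM hi, hjM⟩⟩)
  have hds : Disjoint s1 s2 := by
    rw [Finset.disjoint_left]
    intro i h1 h2
    exact (Finset.mem_sdiff.1 (hs2 h2)).2 (hs1 h1)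
  refine ⟨s1 ∪ s2, Finset.union_subset (hs1.trans hCM) (hs2.trans hss.1), ?_, ?_⟩
  · rw [Finset.coe_union, Set.pairwiseDisjoint_union]
    exact ⟨hd1, hd2, fun i hi j hj _ => hcross i (hs1 hi) j (hs2 hj)⟩
  · rw [Finset.sum_union hds, mul_add]
    refine le_trans ?_ (add_le_add hv1 hv2)
    refine le_trans (measure_mono ?_) (measure_union_le _ _)
    refine iUnion₂_subset fun i hi x hx => ?_
    by_cases h : i ∈ C
    · left; simp only [mem_iUnion, exists_prop]; exact ⟨i, h, hx⟩
    · right; simp only [mem_iUnion, exists_prop]; exact ⟨i, Finset.mem_sdiff.2 ⟨hi, h⟩, hx⟩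

/-- Balls that are `5`-maximal, dilated by `3/2`, cover all balls. -/
lemma maximal_cover {X : Type*} [PseudoMetricSpace X] {ι : Type*} (S : Finset ι) (c : ι → X)
    (r : ι → ℝ) (hr : ∀ i ∈ S, 0 < r i) (i : ι) (hi : i ∈ S) :
    ∃ j ∈ S, (∀ k ∈ S, (ball (c j) (r j) ∩ ball (c k) (r k)).Nonempty → r k ≤ 5 * r j) ∧
      dist (c i) (c j) + 3/2 * r i ≤ 3/2 * r j := by
  classical
  by_contra hcon
  let T := S.filter (fun i => ¬ ∃ j ∈ S,
    (∀ k ∈ S, (ball (c j) (r j) ∩ ball (c k) (r k)).Nonempty → r k ≤ 5 * r j) ∧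
      dist (c i) (c j) + 3/2 * r i ≤ 3/2 * r j)
  have hT : T.Nonempty := ⟨i, Finset.mem_filter.2 ⟨hi, hcon⟩⟩
  obtain ⟨m, hm, hmax⟩ := T.exists_max_image r hT
  obtain ⟨hmS, hmn⟩ := Finset.mem_filter.1 hm
  by_cases hM : ∀ k ∈ S, (ball (c m) (r m) ∩ ball (c k) (r k)).Nonempty → r k ≤ 5 * r m
  · exact hmn ⟨m, hmS, hM, by simp⟩
  · push Not at hM
    obtain ⟨k, hk, ⟨y, hy1, hy2⟩, hlt⟩ := hM
    have hrm := hr m hmS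
    have hkT : k ∉ T := fun h => by have := hmax k h; linarith
    have : ∃ j ∈ S,
      (∀ l ∈ S, (ball (c j) (r j) ∩ ball (c l) (r l)).Nonempty → r l ≤ 5 * r j) ∧
      dist (c k) (c j) + 3/2 * r k ≤ 3/2 * r j := by
      by_contra h
      exact hkT (Finset.mem_filter.2 ⟨hk, h⟩)
    obtain ⟨j, hj, hjM, hjd⟩ := this
    refine hmn ⟨j, hj, hjM, ?_⟩
    have h1 := dist_triangle (c m) (c k) (c j)
    have h2 := dist_triangle (c m) y (c k)
    rw [mem_ball] at hy1 hy2
    rw [dist_comm] at hy1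
    linarith

/-- Finite greedy Vitali selection. -/
lemma greedy {X : Type*} [PseudoMetricSpace X] {ι : Type*} [DecidableEq ι] (M : Finset ι)
    (c : ι → X) (r : ι → ℝ) (hr : ∀ i ∈ M, 0 < r i) :
    ∃ sel ⊆ M, (sel : Set ι).PairwiseDisjoint (fun i => ball (c i) (r i)) ∧
      ∀ i ∈ M, ∃ j ∈ sel, (ball (c i) (r i) ∩ ball (c j) (r j)).Nonempty ∧ r i ≤ r j := by
  classical
  induction M using Finset.strongInduction with
  | H M ih =>
  rcases M.eq_empty_or_nonempty with rfl | hne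
  · exact ⟨∅, by simp⟩
  obtain ⟨m, hm, hmax⟩ := M.exists_max_image r hne
  let M' := M.filter (fun i => Disjoint (ball (c i) (r i)) (ball (c m) (r m)))
  have hmself : (ball (c m) (r m) ∩ ball (c m) (r m)).Nonempty :=
    ⟨c m, mem_ball_self (hr m hm), mem_ball_self (hr m hm)⟩
  have hss : M' ⊂ M := by
    refine Finset.filter_ssubset.2 ⟨m, hm, ?_⟩
    rw [Set.not_disjoint_iff_nonempty_inter]; exact hmself
  obtain ⟨s, hs, hd, hcov⟩ := ih M' hss (fun i hi => hr i (hss.1 hi))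
  refine ⟨insert m s, Finset.insert_subset hm (hs.trans hss.1), ?_, ?_⟩
  · rw [Finset.coe_insert, Set.pairwiseDisjoint_insert]
    exact ⟨hd, fun j hj _ => (Finset.mem_filter.1 (hs hj)).2.symm⟩
  · intro i hi
    by_cases h : Disjoint (ball (c i) (r i)) (ball (c m) (r m))
    · obtain ⟨j, hj, h1, h2⟩ := hcov i (Finset.mem_filter.2 ⟨hi, h⟩)
      exact ⟨j, Finset.mem_insert_of_mem hj, h1, h2⟩
    · exact ⟨m, Finset.mem_insert_self _ _, Set.not_disjoint_iff_nonempty_inter.1 h, hmax i hi⟩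

lemma slice_half_one {ι : Type*} [DecidableEq ι] (M : Finset ι)
    (c : ι → EuclideanSpace ℝ (Fin 1)) (r : ι → ℝ) (hr : ∀ i ∈ M, 0 < r i) :
    ∃ sel ⊆ M, (sel : Set ι).PairwiseDisjoint (fun i => ball (c i) (r i)) ∧
      volume (⋃ i ∈ M, ball (c i) (3/2 * r i)) ≤
        ENNReal.ofReal ((5 : ℝ) ^ 1 / 2) * ∑ i ∈ sel, volume (ball (c i) (r i)) := by
  let f : EuclideanSpace ℝ (Fin 1) → ℝ := fun x => x 0
  have hf : MeasurePreserving f volume volume :=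
    (volume_preserving_funUnique (Fin 1) ℝ).comp (PiLp.volume_preserving_ofLp (Fin 1))
  have hball : ∀ (x : EuclideanSpace ℝ (Fin 1)) (ρ : ℝ),
      ball x ρ = f ⁻¹' (Ioo (x 0 - ρ) (x 0 + ρ)) := by
    intro x ρ
    ext y
    rw [mem_ball, EuclideanSpace.dist_eq, ← Real.ball_eq_Ioo, mem_preimage, mem_ball]
    simp [f, Real.sqrt_sq]
  obtain ⟨sel, hs, hd, hv⟩ := interval_slice (fun i => c i 0) r M hr
  refine ⟨sel, hs, ?_, ?_⟩
  · intro i hi j hj hij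
    have := hd hi hj hij
    simp only [Function.onFun, hball] at this ⊢
    exact this.preimage f
  · simp only [hball, ← preimage_iUnion]
    rw [hf.measure_preimage
      (Finset.measurableSet_biUnion M fun i _ => measurableSet_Ioo).nullMeasurableSet]
    simp only [hf.measure_preimage measurableSet_Ioo.nullMeasurableSet]
    rw [pow_one]
    exact hv

lemma slice_half_ge_two (d : ℕ) (hd : 2 ≤ d) {ι : Type*} [DecidableEq ι] (M : Finset ι)
    (c : ι → EuclideanSpace ℝ (Fin d)) (r : ι → ℝ) (hr : ∀ i ∈ M, 0 < r i) :
    ∃ sel ⊆ M, (sel : Set ι).PairwiseDisjoint (fun i => ball (c i) (r i)) ∧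
      volume (⋃ i ∈ M, ball (c i) (3/2 * r i)) ≤
        ENNReal.ofReal ((5 : ℝ) ^ d / 2) * ∑ i ∈ sel, volume (ball (c i) (r i)) := by
  obtain ⟨sel, hs, hdis, hcov⟩ := greedy M c r hr
  refine ⟨sel, hs, hdis, ?_⟩
  have hsub : (⋃ i ∈ M, ball (c i) (3/2 * r i)) ⊆ ⋃ j ∈ sel, ball (c j) (7/2 * r j) := by
    refine iUnion₂_subset fun i hi x hx => ?_
    obtain ⟨j, hj, ⟨y, hy1, hy2⟩, hle⟩ := hcov i hi
    simp only [mem_iUnion, exists_prop]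
    refine ⟨j, hj, ?_⟩
    rw [mem_ball] at *
    have h1 := dist_triangle x (c i) (c j)
    have h2 := dist_triangle (c i) y (c j)
    rw [dist_comm] at hy1
    linarith
  refine (measure_mono hsub).trans ((measure_biUnion_finset_le _ _).trans ?_)
  rw [Finset.mul_sum]
  refine Finset.sum_le_sum fun j hj => ?_
  rw [Measure.addHaar_ball_mul_of_pos volume (c j) (by norm_num : (0:ℝ) < 7/2),
    Measure.addHaar_ball_center volume (c j)]
  gcongr
  rw [finrank_euclideanSpace_fin]
  obtain ⟨k, rfl⟩ := Nat.exists_eq_add_of_le hd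
  have : (7/2 : ℝ) ^ k ≤ 5 ^ k := by gcongr; norm_num
  have h5 : (0:ℝ) < 5 ^ k := by positivity
  rw [pow_add, pow_add]
  nlinarith

lemma slice_lemma (d : ℕ) (hd : 1 ≤ d) {ι : Type*} (S : Finset ι)
    (c : ι → EuclideanSpace ℝ (Fin d)) (r : ι → ℝ) (hr : ∀ i ∈ S, 0 < r i) :
    ∃ sel ⊆ S, (sel : Set ι).PairwiseDisjoint (fun i => ball (c i) (r i)) ∧
      (∀ i ∈ sel, ∀ j ∈ S, (ball (c i) (r i) ∩ ball (c j) (r j)).Nonempty → r j ≤ 5 * r i) ∧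
      volume (⋃ i ∈ S, ball (c i) (r i)) ≤
        ENNReal.ofReal ((5 : ℝ) ^ d / 2) * ∑ i ∈ sel, volume (ball (c i) (r i)) := by
  classical
  let M := S.filter (fun i => ∀ j ∈ S,
    (ball (c i) (r i) ∩ ball (c j) (r j)).Nonempty → r j ≤ 5 * r i)
  have hMS : M ⊆ S := Finset.filter_subset _ _
  have hsub : (⋃ i ∈ S, ball (c i) (r i)) ⊆ ⋃ i ∈ M, ball (c i) (3/2 * r i) := by
    refine iUnion₂_subset fun i hi x hx => ?_
    obtain ⟨j, hj, hjM, hjd⟩ := maximal_cover S c r hr i hi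
    simp only [mem_iUnion, exists_prop]
    refine ⟨j, Finset.mem_filter.2 ⟨hj, hjM⟩, ?_⟩
    rw [mem_ball] at *
    have h1 := dist_triangle x (c i) (c j)
    have := hr i hi
    linarith
  have : ∃ sel ⊆ M, (sel : Set ι).PairwiseDisjoint (fun i => ball (c i) (r i)) ∧
      volume (⋃ i ∈ M, ball (c i) (3/2 * r i)) ≤
        ENNReal.ofReal ((5 : ℝ) ^ d / 2) * ∑ i ∈ sel, volume (ball (c i) (r i)) := by
    rcases Nat.lt_or_ge d 2 with h | h
    · obtain rfl : d = 1 := by omega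
      exact slice_half_one M c r (fun i hi => hr i (hMS hi))
    · exact slice_half_ge_two d h M c r (fun i hi => hr i (hMS hi))
  obtain ⟨sel, hs, hd', hv⟩ := this
  exact ⟨sel, hs.trans hMS, hd', fun i hi => (Finset.mem_filter.1 (hs hi)).2,
    (measure_mono hsub).trans hv⟩

lemma side_bound (d : ℕ) (α : ℝ) (hα : 0 < α) {ι : Type*} (I : Finset ι)
    (c : ι → EuclideanSpace ℝ (Fin d)) (τ r : ι → ℝ) (hr : ∀ i ∈ I, 0 < r i)
    (P : ℝ → Finset ι)
    (hP1 : ∀ t, ∀ i ∈ P t, i ∈ I ∧ t ∈ Ioc (τ i - r i ^ α) (τ i))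
    (hP2 : ∀ t, (P t : Set ι).PairwiseDisjoint (fun i => ball (c i) (r i)))
    (hP3 : ∀ t, ∀ i ∈ P t, ∀ j ∈ I, t ∈ Ioc (τ j - r j ^ α) (τ j) →
      (ball (c i) (r i) ∩ ball (c j) (r j)).Nonempty → r j ≤ 5 * r i)
    (hmeas : ∀ i, MeasurableSet {t | i ∈ P t})
    (x : EuclideanSpace ℝ (Fin d)) (s : ℝ) (H : Set ℝ) (hHm : MeasurableSet H)
    (hH : ∀ t ∈ H, ∀ t' ∈ H, |t - s| ≤ |t' - s| → t ∈ uIcc s t')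
    (hHv : ∀ ρ : ℝ, volume (H ∩ closedBall s ρ) ≤ ENNReal.ofReal ρ)
    (J : Finset ι) (hJ : ∀ i ∈ J, i ∈ I ∧ (x, s) ∈ pcyl d α (c i) (τ i) (r i)) :
    ∑ i ∈ J, volume ({t | i ∈ P t} ∩ H) / ENNReal.ofReal (r i ^ α) ≤
      ENNReal.ofReal (5 ^ α) := by
  classical
  let J' := J.filter (fun i => ({t | i ∈ P t} ∩ H).Nonempty)
  have hJJ : ∑ i ∈ J', volume ({t | i ∈ P t} ∩ H) / ENNReal.ofReal (r i ^ α) =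
      ∑ i ∈ J, volume ({t | i ∈ P t} ∩ H) / ENNReal.ofReal (r i ^ α) := by
    apply Finset.sum_filter_of_ne
    intro i _ hne
    by_contra hcon
    rw [not_nonempty_iff_eq_empty] at hcon
    rw [hcon] at hne
    simp at hne
  rw [← hJJ]
  rcases J'.eq_empty_or_nonempty with h0 | hne
  · rw [h0]; simp
  obtain ⟨m, hm, hmin⟩ := J'.exists_min_image r hne
  obtain ⟨hmJ, t0, ht0P, ht0H⟩ := Finset.mem_filter.1 hm
  obtain ⟨hmI, hmx⟩ := hJ m hmJ
  have hrm := hr m hmI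
  have hrma : 0 < r m ^ α := Real.rpow_pos_of_pos hrm α
  have habs : ∀ i t, t ∈ Ioc (τ i - r i ^ α) (τ i) → s ∈ Ioc (τ i - r i ^ α) (τ i) →
      |t - s| ≤ r i ^ α := by
    intro i t h1 h2
    rw [abs_le]
    exact ⟨by linarith [h1.1, h2.2], by linarith [h1.2, h2.1]⟩
  have h51 : (1:ℝ) ≤ 5 ^ α := Real.one_le_rpow (by norm_num) hα.le
  have hsub : (⋃ i ∈ J', ({t | i ∈ P t} ∩ H)) ⊆ H ∩ closedBall s (5 ^ α * r m ^ α) := by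
    refine iUnion₂_subset fun j hj t ht => ⟨ht.2, ?_⟩
    obtain ⟨hjJ, _⟩ := Finset.mem_filter.1 hj
    obtain ⟨hjI, hjx⟩ := hJ j hjJ
    have htj := (hP1 t j ht.1).2
    have ht0m := (hP1 t0 m ht0P).2
    rw [mem_closedBall, Real.dist_eq]
    rcases le_total |t0 - s| |t - s| with h | h
    · have h1 := hH t0 ht0H t ht.2 h
      have h2 : t0 ∈ Ioc (τ j - r j ^ α) (τ j) := by
        have := ordConnected_Ioc.uIcc_subset hjx.2 htj
        exact this h1
      have h3 := hP3 t0 m ht0P j hjI h2 ⟨x, hmx.1, hjx.1⟩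
      calc |t - s| ≤ r j ^ α := habs j t htj hjx.2
        _ ≤ (5 * r m) ^ α := Real.rpow_le_rpow (hr j hjI).le h3 hα.le
        _ = 5 ^ α * r m ^ α := Real.mul_rpow (by norm_num) hrm.le
    · calc |t - s| ≤ |t0 - s| := h
        _ ≤ r m ^ α := habs m t0 ht0m hmx.2
        _ ≤ 5 ^ α * r m ^ α := by nlinarith
  have hdis : (J' : Set ι).PairwiseDisjoint (fun i => {t | i ∈ P t} ∩ H) := by
    intro i hi j hj hij
    rw [Function.onFun, Set.disjoint_left]
    rintro t ⟨hti, _⟩ ⟨htj, _⟩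
    have hd := hP2 t hti htj hij
    have hix := (hJ i (Finset.mem_filter.1 hi).1).2.1
    have hjx := (hJ j (Finset.mem_filter.1 hj).1).2.1
    exact Set.disjoint_left.1 hd hix hjx
  calc ∑ i ∈ J', volume ({t | i ∈ P t} ∩ H) / ENNReal.ofReal (r i ^ α)
      ≤ ∑ i ∈ J', volume ({t | i ∈ P t} ∩ H) / ENNReal.ofReal (r m ^ α) := by
        refine Finset.sum_le_sum fun i hi => ?_
        refine ENNReal.div_le_div_left (ENNReal.ofReal_le_ofReal ?_) _
        exact Real.rpow_le_rpow hrm.le (hmin i hi) hα.le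
    _ = volume (⋃ i ∈ J', ({t | i ∈ P t} ∩ H)) / ENNReal.ofReal (r m ^ α) := by
        rw [measure_biUnion_finset hdis (fun i _ => (hmeas i).inter hHm)]
        simp only [div_eq_mul_inv, Finset.sum_mul]
    _ ≤ ENNReal.ofReal (5 ^ α * r m ^ α) / ENNReal.ofReal (r m ^ α) :=
        ENNReal.div_le_div_right ((measure_mono hsub).trans (hHv _)) _
    _ = ENNReal.ofReal (5 ^ α) := by
        rw [← ENNReal.ofReal_div_of_pos hrma]
        congr 1
        field_simp

lemma point_bound (d : ℕ) (α : ℝ) (hα : 0 < α) {ι : Type*} (I : Finset ι)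
    (c : ι → EuclideanSpace ℝ (Fin d)) (τ r : ι → ℝ) (hr : ∀ i ∈ I, 0 < r i)
    (P : ℝ → Finset ι)
    (hP1 : ∀ t, ∀ i ∈ P t, i ∈ I ∧ t ∈ Ioc (τ i - r i ^ α) (τ i))
    (hP2 : ∀ t, (P t : Set ι).PairwiseDisjoint (fun i => ball (c i) (r i)))
    (hP3 : ∀ t, ∀ i ∈ P t, ∀ j ∈ I, t ∈ Ioc (τ j - r j ^ α) (τ j) →
      (ball (c i) (r i) ∩ ball (c j) (r j)).Nonempty → r j ≤ 5 * r i)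
    (hmeas : ∀ i, MeasurableSet {t | i ∈ P t})
    (x : EuclideanSpace ℝ (Fin d)) (s : ℝ)
    (J : Finset ι) (hJ : ∀ i ∈ J, i ∈ I ∧ (x, s) ∈ pcyl d α (c i) (τ i) (r i)) :
    ∑ i ∈ J, volume {t | i ∈ P t} / ENNReal.ofReal (r i ^ α) ≤
      ENNReal.ofReal (2 * 5 ^ α) := by
  have h1 := side_bound d α hα I c τ r hr P hP1 hP2 hP3 hmeas x s (Ici s) measurableSet_Ici
    (by
      intro t ht t' ht' h
      rw [mem_Ici] at ht ht'
      rw [abs_of_nonneg (by linarith), abs_of_nonneg (by linarith)] at h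
      rw [uIcc_of_le ht']
      exact ⟨ht, by linarith⟩)
    (by
      intro ρ
      have : Ici s ∩ closedBall s ρ ⊆ Icc s (s + ρ) := by
        rintro t ⟨h1, h2⟩
        rw [Real.closedBall_eq_Icc] at h2
        exact ⟨h1, h2.2⟩
      refine (measure_mono this).trans ?_
      rw [Real.volume_Icc]; simp) J hJ
  have h2 := side_bound d α hα I c τ r hr P hP1 hP2 hP3 hmeas x s (Iic s) measurableSet_Iic
    (by
      intro t ht t' ht' h
      rw [mem_Iic] at ht ht'
      rw [abs_of_nonpos (by linarith), abs_of_nonpos (by linarith)] at h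
      rw [uIcc_of_ge ht']
      exact ⟨by linarith, ht⟩)
    (by
      intro ρ
      have : Iic s ∩ closedBall s ρ ⊆ Icc (s - ρ) s := by
        rintro t ⟨h1, h2⟩
        rw [Real.closedBall_eq_Icc] at h2
        exact ⟨h2.1, h1⟩
      refine (measure_mono this).trans ?_
      rw [Real.volume_Icc]; simp) J hJ
  have h5 : (0:ℝ) ≤ 5 ^ α := by positivity
  rw [two_mul, ENNReal.ofReal_add h5 h5]
  refine le_trans ?_ (add_le_add h1 h2)
  rw [← Finset.sum_add_distrib]
  refine Finset.sum_le_sum fun i _ => ?_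
  rw [← ENNReal.add_div]
  refine ENNReal.div_le_div_right ?_ _
  refine le_trans (measure_mono ?_) (measure_union_le _ _)
  intro t ht
  rcases le_total s t with h | h
  · exact Or.inl ⟨ht, h⟩
  · exact Or.inr ⟨ht, h⟩

lemma pcyl_measurable (d : ℕ) (α : ℝ) (x : EuclideanSpace ℝ (Fin d)) (t r : ℝ) :
    MeasurableSet (pcyl d α x t r) := measurableSet_ball.prod measurableSet_Ioc

lemma pcyl_volume (d : ℕ) (α : ℝ) (x : EuclideanSpace ℝ (Fin d)) (t r : ℝ) :
    volume (pcyl d α x t r) = volume (ball x r) * ENNReal.ofReal (r ^ α) := by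
  rw [pcyl, Measure.volume_eq_prod, Measure.prod_prod, Real.volume_Ioc]
  congr 2; ring

/-- Finite covering estimate with constant `5^{d+α}`. -/
lemma core (d : ℕ) (hd : 1 ≤ d) (α : ℝ) (hα : 0 < α) {ι : Type*} (I : Finset ι)
    (c : ι → EuclideanSpace ℝ (Fin d)) (τ r : ι → ℝ) (hr : ∀ i ∈ I, 0 < r i)
    (G : Set (EuclideanSpace ℝ (Fin d) × ℝ)) (m : ENNReal)
    (hm : ∀ i ∈ I, m * volume (pcyl d α (c i) (τ i) (r i)) ≤
      volume (pcyl d α (c i) (τ i) (r i) ∩ G)) :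
    m * volume (⋃ i ∈ I, pcyl d α (c i) (τ i) (r i)) ≤
      ENNReal.ofReal (5 ^ ((d : ℝ) + α)) * volume G := by
  classical
  let S : ℝ → Finset ι := fun t => I.filter (fun i => t ∈ Ioc (τ i - r i ^ α) (τ i))
  have hsl : ∀ S' : Finset ι, ∃ sel : Finset ι, S' ⊆ I → (sel ⊆ S' ∧
      (sel : Set ι).PairwiseDisjoint (fun i => ball (c i) (r i)) ∧
      (∀ i ∈ sel, ∀ j ∈ S', (ball (c i) (r i) ∩ ball (c j) (r j)).Nonempty → r j ≤ 5 * r i) ∧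
      volume (⋃ i ∈ S', ball (c i) (r i)) ≤
        ENNReal.ofReal ((5 : ℝ) ^ d / 2) * ∑ i ∈ sel, volume (ball (c i) (r i))) := by
    intro S'
    by_cases h : S' ⊆ I
    · obtain ⟨sel, h1, h2, h3, h4⟩ := slice_lemma d hd S' c r (fun i hi => hr i (h hi))
      exact ⟨sel, fun _ => ⟨h1, h2, h3, h4⟩⟩
    · exact ⟨∅, fun h' => absurd h' h⟩
  choose f hf using hsl
  let P : ℝ → Finset ι := fun t => f (S t)
  have hSI : ∀ t, S t ⊆ I := fun t => Finset.filter_subset _ _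
  have hmeas : ∀ i, MeasurableSet {t | i ∈ P t} := by
    intro i
    have hS' : ∀ S' : Finset ι, MeasurableSet {t | S t = S'} := by
      intro S'
      by_cases h : S' ⊆ I
      · have : {t | S t = S'} = ⋂ i ∈ I, {t | t ∈ Ioc (τ i - r i ^ α) (τ i) ↔ i ∈ S'} := by
          ext t
          simp only [mem_iInter]
          constructor
          · intro ht j hj
            have ht : S t = S' := ht
            change _ ↔ _
            rw [← ht]
            simp [S, hj]
          · intro ht
            change S t = S'
            ext j
            constructor
            · intro hj
              obtain ⟨hj1, hj2⟩ := Finset.mem_filter.1 hj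
              exact (ht j hj1).1 hj2
            · intro hj
              exact Finset.mem_filter.2 ⟨h hj, (ht j (h hj)).2 hj⟩
        rw [this]
        refine Finset.measurableSet_biInter I fun j _ => ?_
        by_cases hj : j ∈ S'
        · simp only [hj, iff_true]; exact measurableSet_Ioc
        · simp only [hj, iff_false]; exact measurableSet_Ioc.compl
      · have : {t | S t = S'} = ∅ := by
          apply eq_empty_of_forall_notMem
          intro t ht
          have ht : S t = S' := ht
          exact h (ht ▸ hSI t)
        rw [this]; exact MeasurableSet.empty
    have : {t | i ∈ P t} = ⋃ S' ∈ I.powerset.filter (fun S' => i ∈ f S'), {t | S t = S'} := by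
      ext t
      simp only [mem_iUnion, exists_prop, Finset.mem_filter, Finset.mem_powerset]
      constructor
      · intro ht
        exact ⟨S t, ⟨hSI t, ht⟩, rfl⟩
      · rintro ⟨S', ⟨_, h2⟩, h3⟩
        have h3 : S t = S' := h3
        change i ∈ f (S t)
        rw [h3]; exact h2
    rw [this]
    exact Finset.measurableSet_biUnion _ fun S' _ => hS' S'
  have hP1 : ∀ t, ∀ i ∈ P t, i ∈ I ∧ t ∈ Ioc (τ i - r i ^ α) (τ i) := fun t i hi =>
    Finset.mem_filter.1 ((hf (S t) (hSI t)).1 hi)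
  have hP2 : ∀ t, (P t : Set ι).PairwiseDisjoint (fun i => ball (c i) (r i)) := fun t =>
    (hf (S t) (hSI t)).2.1
  have hP3 : ∀ t, ∀ i ∈ P t, ∀ j ∈ I, t ∈ Ioc (τ j - r j ^ α) (τ j) →
      (ball (c i) (r i) ∩ ball (c j) (r j)).Nonempty → r j ≤ 5 * r i := fun t i hi j hj ht =>
    (hf (S t) (hSI t)).2.2.1 i hi j (Finset.mem_filter.2 ⟨hj, ht⟩)
  have hP4 := fun t => (hf (S t) (hSI t)).2.2.2
  set A := ENNReal.ofReal ((5 : ℝ) ^ d / 2) with hA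
  have hUm : MeasurableSet (⋃ i ∈ I, pcyl d α (c i) (τ i) (r i)) :=
    Finset.measurableSet_biUnion _ fun i _ => pcyl_measurable _ _ _ _ _
  have step1 : volume (⋃ i ∈ I, pcyl d α (c i) (τ i) (r i)) ≤
      A * ∑ i ∈ I, volume {t | i ∈ P t} * volume (ball (c i) (r i)) := by
    rw [Measure.volume_eq_prod, Measure.prod_apply_symm hUm]
    calc ∫⁻ t, volume ((fun x => (x, t)) ⁻¹' (⋃ i ∈ I, pcyl d α (c i) (τ i) (r i)))
        ≤ ∫⁻ t, A * ∑ i ∈ I, ({t | i ∈ P t}.indicator (fun _ => volume (ball (c i) (r i))) t) := by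
          refine lintegral_mono fun t => ?_
          have e1 : ((fun x => (x, t)) ⁻¹' (⋃ i ∈ I, pcyl d α (c i) (τ i) (r i))) =
              ⋃ i ∈ S t, ball (c i) (r i) := by
            ext x
            simp only [mem_preimage, mem_iUnion, exists_prop, pcyl, mem_prod, S,
              Finset.mem_filter]
            constructor
            · rintro ⟨i, h1, h2, h3⟩; exact ⟨i, ⟨h1, h3⟩, h2⟩
            · rintro ⟨i, ⟨h1, h3⟩, h2⟩; exact ⟨i, h1, h2, h3⟩
          rw [e1]
          refine (hP4 t).trans (le_of_eq ?_)
          congr 1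
          have e2 : f (S t) = I.filter (fun i => i ∈ P t) := by
            ext i
            simp only [Finset.mem_filter]
            exact ⟨fun h => ⟨(hP1 t i h).1, h⟩, fun h => h.2⟩
          rw [e2, Finset.sum_filter]
          refine Finset.sum_congr rfl fun i _ => ?_
          simp [indicator_apply]
      _ = A * ∑ i ∈ I, volume {t | i ∈ P t} * volume (ball (c i) (r i)) := by
          rw [lintegral_const_mul _ (Finset.measurable_fun_sum _ fun i _ =>
            measurable_const.indicator (hmeas i)),
            lintegral_finsetSum _ (fun i _ => measurable_const.indicator (hmeas i))]
          congr 1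
          refine Finset.sum_congr rfl fun i _ => ?_
          rw [lintegral_indicator_const (hmeas i), mul_comm]
  have step2 : m * ∑ i ∈ I, volume {t | i ∈ P t} * volume (ball (c i) (r i)) ≤
      ENNReal.ofReal (2 * 5 ^ α) * volume G := by
    calc m * ∑ i ∈ I, volume {t | i ∈ P t} * volume (ball (c i) (r i))
        ≤ ∑ i ∈ I, volume {t | i ∈ P t} / ENNReal.ofReal (r i ^ α) *
            volume (pcyl d α (c i) (τ i) (r i) ∩ G) := by
          rw [Finset.mul_sum]
          refine Finset.sum_le_sum fun i hi => ?_
          have hra : 0 < r i ^ α := Real.rpow_pos_of_pos (hr i hi) α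
          have hne0 : ENNReal.ofReal (r i ^ α) ≠ 0 := by
            rw [Ne, ENNReal.ofReal_eq_zero]; linarith
          have hnet : ENNReal.ofReal (r i ^ α) ≠ ⊤ := ENNReal.ofReal_ne_top
          refine le_trans (le_of_eq ?_) (mul_le_mul_right (hm i hi) _)
          rw [pcyl_volume]
          calc m * (volume {t | i ∈ P t} * volume (ball (c i) (r i)))
              = volume {t | i ∈ P t} * 1 * (m * volume (ball (c i) (r i))) := by ring
            _ = volume {t | i ∈ P t} * ((ENNReal.ofReal (r i ^ α))⁻¹ * ENNReal.ofReal (r i ^ α)) *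
                  (m * volume (ball (c i) (r i))) := by rw [ENNReal.inv_mul_cancel hne0 hnet]
            _ = _ := by rw [div_eq_mul_inv]; ring
      _ = ∫⁻ p in G, ∑ i ∈ I, (pcyl d α (c i) (τ i) (r i)).indicator
            (fun _ => volume {t | i ∈ P t} / ENNReal.ofReal (r i ^ α)) p := by
          rw [lintegral_finsetSum _ (fun i _ =>
            measurable_const.indicator (pcyl_measurable _ _ _ _ _))]
          refine Finset.sum_congr rfl fun i _ => ?_
          rw [lintegral_indicator_const (pcyl_measurable _ _ _ _ _),
            Measure.restrict_apply (pcyl_measurable _ _ _ _ _)]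
      _ ≤ ∫⁻ p in G, ENNReal.ofReal (2 * 5 ^ α) := by
          refine lintegral_mono fun p => ?_
          have := point_bound d α hα I c τ r hr P hP1 hP2 hP3 hmeas p.1 p.2
            (I.filter (fun i => p ∈ pcyl d α (c i) (τ i) (r i)))
            (fun i hi => Finset.mem_filter.1 hi)
          refine le_trans (le_of_eq ?_) this
          rw [Finset.sum_filter]
          refine Finset.sum_congr rfl fun i _ => ?_
          rw [indicator_apply]
      _ = ENNReal.ofReal (2 * 5 ^ α) * volume G := by
          rw [setLIntegral_const]
  calc m * volume (⋃ i ∈ I, pcyl d α (c i) (τ i) (r i))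
      ≤ m * (A * ∑ i ∈ I, volume {t | i ∈ P t} * volume (ball (c i) (r i))) :=
        mul_le_mul_right step1 _
    _ = A * (m * ∑ i ∈ I, volume {t | i ∈ P t} * volume (ball (c i) (r i))) := by ring
    _ ≤ A * (ENNReal.ofReal (2 * 5 ^ α) * volume G) := mul_le_mul_right step2 _
    _ = ENNReal.ofReal (5 ^ ((d : ℝ) + α)) * volume G := by
        rw [← mul_assoc, hA, ← ENNReal.ofReal_mul (by positivity)]
        congr 2
        rw [Real.rpow_add (by norm_num), Real.rpow_natCast]
        ring

lemma pcyl_volume_scale (d : ℕ) (α : ℝ) (x x' : EuclideanSpace ℝ (Fin d)) (t t' r q : ℝ)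
    (hr : 0 < r) (hq : 0 < q) :
    volume (pcyl d α x' t' (q * r)) =
      ENNReal.ofReal (q ^ d * q ^ α) * volume (pcyl d α x t r) := by
  rw [pcyl_volume, pcyl_volume, Measure.addHaar_ball_mul_of_pos volume x' hq r,
    finrank_euclideanSpace_fin, Real.mul_rpow hq.le hr.le, ENNReal.ofReal_mul (by positivity),
    ENNReal.ofReal_mul (by positivity), Measure.addHaar_ball_center volume x r]
  ring

lemma pcyl_volume_ne_top (d : ℕ) (α : ℝ) (x : EuclideanSpace ℝ (Fin d)) (t r : ℝ) :
    volume (pcyl d α x t r) ≠ ⊤ := by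
  rw [pcyl_volume]
  exact ENNReal.mul_ne_top measure_ball_lt_top.ne ENNReal.ofReal_ne_top

lemma shrink_mono (d : ℕ) (α : ℝ) (hα : 0 < α) (x y : EuclideanSpace ℝ (Fin d)) (t u r : ℝ)
    (hr : 0 < r) (hy : y ∈ ball x r) (hu : u ∈ Ioo (t - r ^ α) t) (s s' : ℝ) (hs : 0 < s)
    (hss : s ≤ s') :
    pcyl d α (y + s • (x - y)) (u + s ^ α * (t - u)) (s * r) ⊆
      pcyl d α (y + s' • (x - y)) (u + s' ^ α * (t - u)) (s' * r) := by
  have hs' : 0 < s' := hs.trans_le hss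
  have hp : s ^ α ≤ s' ^ α := Real.rpow_le_rpow hs.le hss hα.le
  refine prod_mono (ball_subset_ball' ?_) (Ioc_subset_Ioc ?_ ?_)
  · have : dist (y + s • (x - y)) (y + s' • (x - y)) = (s' - s) * dist y x := by
      rw [dist_add_left, dist_eq_norm, ← sub_smul, norm_smul, Real.norm_eq_abs,
        abs_sub_comm, abs_of_nonneg (by linarith), dist_comm, dist_eq_norm]
    rw [this]
    rw [mem_ball] at hy
    nlinarith
  · rw [Real.mul_rpow hs.le hr.le, Real.mul_rpow hs'.le hr.le]
    nlinarith [hu.1]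
  · nlinarith [hu.2]

lemma shrink_mem (d : ℕ) (α : ℝ) (x y : EuclideanSpace ℝ (Fin d)) (t u r : ℝ)
    (hr : 0 < r) (hy : y ∈ ball x r) (hu : u ∈ Ioo (t - r ^ α) t) (s : ℝ) (hs : 0 < s) :
    (y, u) ∈ ball (y + s • (x - y)) (s * r) ×ˢ
      Ioo (u + s ^ α * (t - u) - (s * r) ^ α) (u + s ^ α * (t - u)) := by
  have hp : 0 < s ^ α := Real.rpow_pos_of_pos hs _
  refine ⟨?_, ?_, ?_⟩
  · simp only [mem_ball] at hy ⊢
    rw [dist_self_add_right, norm_smul, Real.norm_eq_abs, abs_of_pos hs, ← dist_eq_norm, dist_comm]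
    exact mul_lt_mul_of_pos_left hy hs
  · simp only
    rw [Real.mul_rpow hs.le hr.le]
    nlinarith [hu.1]
  · simp only
    nlinarith [hu.2]

lemma shrink_small (d : ℕ) (α : ℝ) (hα : 0 < α) (x y : EuclideanSpace ℝ (Fin d)) (t u r : ℝ)
    (hr : 0 < r) (hy : y ∈ ball x r) (hu : u ∈ Ioo (t - r ^ α) t)
    (F : Set (EuclideanSpace ℝ (Fin d) × ℝ)) (hF : IsOpen F) (hp : (y, u) ∈ F)
    (a : ℝ) (ha : 0 < a) (ha1 : a < 1) :
    ∃ n : ℕ, pcyl d α (y + a ^ n • (x - y)) (u + (a ^ n) ^ α * (t - u)) (a ^ n * r) ⊆ F := by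
  obtain ⟨ε, hε, hεF⟩ := Metric.isOpen_iff.1 hF _ hp
  have h0 := tendsto_pow_atTop_nhds_zero_of_lt_one ha.le ha1
  have h1 : Filter.Tendsto (fun n : ℕ => 2 * (a ^ n * r)) Filter.atTop (nhds 0) := by
    simpa using (h0.mul_const r).const_mul 2
  have h2 : Filter.Tendsto (fun n : ℕ => (a ^ n * r) ^ α) Filter.atTop (nhds 0) := by
    have := (h0.mul_const r).rpow_const (p := α) (Or.inr hα.le)
    simpa [Real.zero_rpow hα.ne'] using this
  obtain ⟨n, hn1, hn2⟩ := ((h1.eventually_lt_const hε).and (h2.eventually_lt_const hε)).exists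
  refine ⟨n, fun z hz => hεF ?_⟩
  have hs : 0 < a ^ n := pow_pos ha n
  generalize a ^ n = s at *
  have hps : 0 < s ^ α := Real.rpow_pos_of_pos hs _
  have hm := shrink_mem d α x y t u r hr hy hu s hs
  obtain ⟨z1, z2, z3⟩ := hz
  obtain ⟨m1, m2, m3⟩ := hm
  simp only at m2 m3
  rw [mem_ball, Prod.dist_eq, max_lt_iff]
  constructor
  · rw [mem_ball] at z1 m1
    have := dist_triangle_right z.1 y (y + s • (x - y))
    simp only at m1 ⊢
    linarith
  · rw [Real.dist_eq, abs_lt]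
    simp only
    constructor <;> linarith

lemma exists_good_cyl
    (d : ℕ) (α : ℝ) (hα : 0 < α)
    (μ : ℝ) (hμ1 : μ < 1) (μ' : ℝ) (hμ' : μ' < μ)
    (E F : Set (EuclideanSpace ℝ (Fin d) × ℝ)) (hFopen : IsOpen F)
    (hi : ∀ p ∈ F, ∃ x t r, 0 < r ∧
      pcyl d α x t r ⊆ (ball (0 : EuclideanSpace ℝ (Fin d)) 1) ×ˢ univ ∧
      p ∈ pcyl d α x t r ∧
      volume (E ∩ pcyl d α x t r) ≤ ENNReal.ofReal (1 - μ) * volume (pcyl d α x t r))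
    (hii : ∀ x t r, 0 < r →
      pcyl d α x t r ⊆ (ball (0 : EuclideanSpace ℝ (Fin d)) 1) ×ˢ univ →
      ENNReal.ofReal (1 - μ) * volume (pcyl d α x t r) < volume (E ∩ pcyl d α x t r) →
      pcyl d α x t r ⊆ F) (p : EuclideanSpace ℝ (Fin d) × ℝ) (hp : p ∈ F) :
    ∃ x t r, 0 < r ∧ p ∈ ball x r ×ˢ Ioo (t - r ^ α) t ∧ pcyl d α x t r ⊆ F ∧
      volume (E ∩ pcyl d α x t r) ≤ ENNReal.ofReal (1 - μ') * volume (pcyl d α x t r) := by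
  obtain ⟨y, u⟩ := p
  obtain ⟨x, t₀, r, hr, hB, ⟨hy, hu0⟩, hE⟩ := hi _ hp
  simp only at hy hu0
  have hra : 0 < r ^ α := Real.rpow_pos_of_pos hr _
  -- shift in time
  obtain ⟨η, hη, hη1, hη2⟩ : ∃ η : ℝ, 0 < η ∧ η < u - (t₀ - r ^ α) ∧ η ≤ (μ - μ') * r ^ α := by
    have h1 : 0 < u - (t₀ - r ^ α) := by linarith [hu0.1]
    have h2 : 0 < (μ - μ') * r ^ α := mul_pos (by linarith) hra
    refine ⟨min (u - (t₀ - r ^ α)) ((μ - μ') * r ^ α) / 2, by positivity, ?_, ?_⟩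
    · have := min_le_left (u - (t₀ - r ^ α)) ((μ - μ') * r ^ α); linarith
    · have := min_le_right (u - (t₀ - r ^ α)) ((μ - μ') * r ^ α); linarith
  obtain ⟨t, ht⟩ : ∃ t, t = t₀ + η := ⟨_, rfl⟩
  have hu : u ∈ Ioo (t - r ^ α) t := ⟨by linarith, by linarith [hu0.2]⟩
  have hballB : ball x r ⊆ ball 0 1 := fun z hz => (hB (show (z, u) ∈ _ from ⟨hz, hu0⟩)).1
  have hB1 : pcyl d α x t r ⊆ (ball (0 : EuclideanSpace ℝ (Fin d)) 1) ×ˢ univ :=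
    prod_mono hballB (subset_univ _)
  have hE1 : volume (E ∩ pcyl d α x t r) ≤
      ENNReal.ofReal (1 - μ') * volume (pcyl d α x t r) := by
    have hsub : E ∩ pcyl d α x t r ⊆ (E ∩ pcyl d α x t₀ r) ∪ ball x r ×ˢ Ioc t₀ t := by
      rintro ⟨a, b⟩ ⟨hab, ha, hb⟩
      simp only at ha hb
      by_cases hbt : b ≤ t₀
      · exact Or.inl ⟨hab, ha, by simp only; linarith [hb.1], hbt⟩
      · exact Or.inr ⟨ha, lt_of_not_ge hbt, hb.2⟩
    have hv : volume (ball x r ×ˢ Ioc t₀ t) ≤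
        ENNReal.ofReal (μ - μ') * volume (pcyl d α x t r) := by
      rw [pcyl_volume, Measure.volume_eq_prod, Measure.prod_prod, Real.volume_Ioc]
      calc volume (ball x r) * ENNReal.ofReal (t - t₀)
          ≤ volume (ball x r) * ENNReal.ofReal ((μ - μ') * r ^ α) := by
            gcongr; linarith
        _ = _ := by rw [ENNReal.ofReal_mul (by linarith)]; ring
    calc volume (E ∩ pcyl d α x t r) ≤ _ := measure_mono hsub
      _ ≤ _ := measure_union_le _ _
      _ ≤ ENNReal.ofReal (1 - μ) * volume (pcyl d α x t r) +
          ENNReal.ofReal (μ - μ') * volume (pcyl d α x t r) := by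
          refine add_le_add (hE.trans_eq ?_) hv
          rw [pcyl_volume, pcyl_volume]
      _ = _ := by
          rw [← add_mul, ← ENNReal.ofReal_add (by linarith) (by linarith)]
          congr 2; ring
  obtain ⟨q, hq1, hq⟩ : ∃ q : ℝ, 1 < q ∧ (1 - μ) * (q ^ d * q ^ α) < 1 - μ' := by
    have hc : ContinuousAt (fun q : ℝ => (1 - μ) * (q ^ d * q ^ α)) 1 := by
      refine continuousAt_const.mul ((continuousAt_id.pow d).mul ?_)
      exact Real.continuousAt_rpow_const _ _ (Or.inl one_ne_zero)
    have h1 : ∀ᶠ q in nhds (1 : ℝ), (1 - μ) * (q ^ d * q ^ α) < 1 - μ' := by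
      apply hc.eventually_lt_const
      simp; linarith
    have h2 := h1.filter_mono (nhdsWithin_le_nhds (s := Ioi 1))
    obtain ⟨q, h3, h4⟩ := (h2.and self_mem_nhdsWithin).exists
    exact ⟨q, h4, h3⟩
  have hq0 : 0 < q := by linarith
  have hex := shrink_small d α hα x y t u r hr hy hu F hFopen hp q⁻¹ (by positivity)
    (inv_lt_one_of_one_lt₀ hq1)
  classical
  have hspec := Nat.find_spec hex
  have hmin := fun m => Nat.find_min hex (m := m)
  generalize Nat.find hex = n at hspec hmin
  have hs : 0 < q⁻¹ ^ n := by positivity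
  refine ⟨_, _, _, mul_pos hs hr, shrink_mem d α x y t u r hr hy hu _ hs, hspec, ?_⟩
  rcases n with _ | n
  · simpa using hE1
  · have hn := hmin n (Nat.lt_succ_self n)
    have hs2 : 0 < q⁻¹ ^ n := by positivity
    have hle1 : q⁻¹ ^ n ≤ 1 := pow_le_one₀ (by positivity) (inv_le_one_of_one_le₀ hq1.le)
    have hqs : q⁻¹ ^ n = q * q⁻¹ ^ (n + 1) := by
      rw [pow_succ]; field_simp
    have hsle : q⁻¹ ^ (n + 1) ≤ q⁻¹ ^ n := by rw [hqs]; nlinarith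
    have hsub1 : pcyl d α (y + q⁻¹ ^ n • (x - y)) (u + (q⁻¹ ^ n) ^ α * (t - u)) (q⁻¹ ^ n * r) ⊆
        pcyl d α x t r := by
      have := shrink_mono d α hα x y t u r hr hy hu _ 1 hs2 hle1
      simpa using this
    have hsub2 := shrink_mono d α hα x y t u r hr hy hu _ _ hs hsle
    have hb : volume (E ∩ pcyl d α (y + q⁻¹ ^ n • (x - y)) (u + (q⁻¹ ^ n) ^ α * (t - u))
        (q⁻¹ ^ n * r)) ≤ ENNReal.ofReal (1 - μ) * volume (pcyl d α (y + q⁻¹ ^ n • (x - y))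
          (u + (q⁻¹ ^ n) ^ α * (t - u)) (q⁻¹ ^ n * r)) := by
      by_contra hcon
      exact hn (hii _ _ _ (mul_pos hs2 hr) (hsub1.trans hB1) (not_le.1 hcon))
    have hvol : volume (pcyl d α (y + q⁻¹ ^ n • (x - y))
          (u + (q⁻¹ ^ n) ^ α * (t - u)) (q⁻¹ ^ n * r)) = ENNReal.ofReal (q ^ d * q ^ α) *
        volume (pcyl d α (y + q⁻¹ ^ (n + 1) • (x - y))
          (u + (q⁻¹ ^ (n + 1)) ^ α * (t - u)) (q⁻¹ ^ (n + 1) * r)) := by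
      rw [← pcyl_volume_scale d α _ (y + q⁻¹ ^ n • (x - y)) _ (u + (q⁻¹ ^ n) ^ α * (t - u)) _ q
        (mul_pos hs hr) hq0, ← mul_assoc, ← hqs]
    refine (measure_mono (inter_subset_inter_right E hsub2)).trans (hb.trans ?_)
    rw [hvol, ← mul_assoc, ← ENNReal.ofReal_mul (by linarith)]
    gcongr

lemma approx_bound
    (d : ℕ) (hd : 1 ≤ d) (α : ℝ) (hα : 0 < α)
    (μ : ℝ) (hμ1 : μ < 1) (μ' : ℝ) (hμ'0 : 0 < μ') (hμ' : μ' < μ)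
    (E F : Set (EuclideanSpace ℝ (Fin d) × ℝ)) (hEopen : IsOpen E) (hFopen : IsOpen F)
    (hi : ∀ p ∈ F, ∃ x t r, 0 < r ∧
      pcyl d α x t r ⊆ (ball (0 : EuclideanSpace ℝ (Fin d)) 1) ×ˢ univ ∧
      p ∈ pcyl d α x t r ∧
      volume (E ∩ pcyl d α x t r) ≤ ENNReal.ofReal (1 - μ) * volume (pcyl d α x t r))
    (hii : ∀ x t r, 0 < r →
      pcyl d α x t r ⊆ (ball (0 : EuclideanSpace ℝ (Fin d)) 1) ×ˢ univ →
      ENNReal.ofReal (1 - μ) * volume (pcyl d α x t r) < volume (E ∩ pcyl d α x t r) →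
      pcyl d α x t r ⊆ F) :
    ENNReal.ofReal μ' * volume F ≤ ENNReal.ofReal (5 ^ ((d : ℝ) + α)) * volume (F \ E) := by
  have hg := exists_good_cyl d α hα μ hμ1 μ' hμ' E F hFopen hi hii
  choose! c τ r hr hmem hsub hden using hg
  rw [hFopen.measure_eq_iSup_isCompact, ENNReal.mul_iSup]
  refine iSup_le fun K => ?_
  rw [ENNReal.mul_iSup]
  refine iSup_le fun hKF => ?_
  rw [ENNReal.mul_iSup]
  refine iSup_le fun hK => ?_
  obtain ⟨I, hIK, hI⟩ := hK.elim_nhds_subcover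
    (fun p => ball (c p) (r p) ×ˢ Ioo (τ p - r p ^ α) (τ p))
    (fun p hp => (isOpen_ball.prod isOpen_Ioo).mem_nhds (hmem p (hKF hp)))
  have hcore := core d hd α hα I c τ r (fun i hi => hr i (hKF (hIK i hi))) (F \ E)
    (ENNReal.ofReal μ') (fun i hi => by
      have hiF := hKF (hIK i hi)
      have h1 := hden i hiF
      have h2 := hsub i hiF
      have h3 := measure_inter_add_diff (μ := volume) (pcyl d α (c i) (τ i) (r i))
        hEopen.measurableSet
      have h4 : pcyl d α (c i) (τ i) (r i) ∩ (F \ E) = pcyl d α (c i) (τ i) (r i) \ E := by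
        ext z; constructor
        · rintro ⟨a, _, b⟩; exact ⟨a, b⟩
        · rintro ⟨a, b⟩; exact ⟨a, h2 a, b⟩
      rw [h4]
      rw [inter_comm] at h3
      have hfin := pcyl_volume_ne_top d α (c i) (τ i) (r i)
      generalize volume (pcyl d α (c i) (τ i) (r i)) = V at *
      have hx : ENNReal.ofReal (1 - μ') * V ≠ ⊤ := ENNReal.mul_ne_top ENNReal.ofReal_ne_top hfin
      refine (ENNReal.add_le_add_iff_left hx).1 ?_
      calc ENNReal.ofReal (1 - μ') * V + ENNReal.ofReal μ' * V = V := by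
            rw [← add_mul, ← ENNReal.ofReal_add (by linarith) (by linarith)]; simp
        _ = _ := h3.symm
        _ ≤ _ := by gcongr)
  refine le_trans ?_ hcore
  gcongr
  refine hI.trans (iUnion₂_mono fun i _ => prod_mono subset_rfl Ioo_subset_Ioc_self)

/-- Vitali-type measure dichotomy (ink-spots lemma): if every point of `F` lies in a
cylinder in which `E` has density at most `1 - μ`, and every cylinder where `E` has
density more than `1 - μ` is contained in `F`, then `|E| ≤ (1 - 5^{-d-α} μ)|F|`. -/
theorem ink_spots_dichotomy
    (d : ℕ) (hd : 1 ≤ d) (α : ℝ) (hα : 0 < α) (hα2 : α ≤ 2)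
    (μ : ℝ) (hμ : 0 < μ) (hμ1 : μ < 1)
    (E F : Set (EuclideanSpace ℝ (Fin d) × ℝ))
    (hEF : E ⊆ F) (hEopen : IsOpen E) (hFopen : IsOpen F)
    (hFB : F ⊆ (ball (0 : EuclideanSpace ℝ (Fin d)) 1) ×ˢ univ)
    (hi : ∀ p ∈ F, ∃ x t r, 0 < r ∧
      pcyl d α x t r ⊆ (ball (0 : EuclideanSpace ℝ (Fin d)) 1) ×ˢ univ ∧
      p ∈ pcyl d α x t r ∧
      volume (E ∩ pcyl d α x t r) ≤ ENNReal.ofReal (1 - μ) * volume (pcyl d α x t r))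
    (hii : ∀ x t r, 0 < r →
      pcyl d α x t r ⊆ (ball (0 : EuclideanSpace ℝ (Fin d)) 1) ×ˢ univ →
      ENNReal.ofReal (1 - μ) * volume (pcyl d α x t r) < volume (E ∩ pcyl d α x t r) →
      pcyl d α x t r ⊆ F) :
    volume E ≤ ENNReal.ofReal (1 - 5 ^ (-(d : ℝ) - α) * μ) * volume F := by
  have hA : (0 : ℝ) < 5 ^ (-(d : ℝ) - α) := by positivity
  have hA1 : (5 : ℝ) ^ (-(d : ℝ) - α) ≤ 1 :=
    Real.rpow_le_one_of_one_le_of_nonpos (by norm_num)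
      (by have : (0 : ℝ) ≤ d := Nat.cast_nonneg d
          linarith)
  have hco : 0 < 1 - 5 ^ (-(d : ℝ) - α) * μ := by nlinarith
  by_cases hF : volume F = ⊤
  · rw [hF, ENNReal.mul_top (by simpa using hco)]
    exact le_top
  have hEfin : volume E ≠ ⊤ := ne_top_of_le_ne_top hF (measure_mono hEF)
  have hGfin : volume (F \ E) ≠ ⊤ := ne_top_of_le_ne_top hF (measure_mono diff_subset)
  have hsum : (volume F).toReal = (volume E).toReal + (volume (F \ E)).toReal := by
    rw [← ENNReal.toReal_add hEfin hGfin, ← measure_inter_add_diff F hEopen.measurableSet,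
      inter_eq_right.2 hEF]
  have hlt : ∀ μ' : ℝ, 0 < μ' → μ' < μ →
      μ' * (volume F).toReal ≤ 5 ^ ((d : ℝ) + α) * (volume (F \ E)).toReal := by
    intro μ' h0 h1
    have := approx_bound d hd α hα μ hμ1 μ' h0 h1 E F hEopen hFopen hi hii
    have h2 := ENNReal.toReal_mono (ENNReal.mul_ne_top ENNReal.ofReal_ne_top hGfin) this
    rwa [ENNReal.toReal_mul, ENNReal.toReal_mul, ENNReal.toReal_ofReal h0.le,
      ENNReal.toReal_ofReal (by positivity)] at h2
  have hlim : μ * (volume F).toReal ≤ 5 ^ ((d : ℝ) + α) * (volume (F \ E)).toReal := by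
    have ht : Filter.Tendsto (fun a : ℝ => a * (volume F).toReal) (nhdsWithin μ (Iio μ))
        (nhds (μ * (volume F).toReal)) :=
      ((continuous_id.mul continuous_const).tendsto μ).mono_left nhdsWithin_le_nhds
    refine le_of_tendsto ht ?_
    filter_upwards [Ioo_mem_nhdsLT hμ] with a ha
    exact hlt a ha.1 ha.2
  have hinv : (5 : ℝ) ^ (-(d : ℝ) - α) * 5 ^ ((d : ℝ) + α) = 1 := by
    rw [← Real.rpow_add (by norm_num)]
    simp
  have hfinal : (volume E).toReal ≤ (1 - 5 ^ (-(d : ℝ) - α) * μ) * (volume F).toReal := by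
    have := mul_le_mul_of_nonneg_left hlim hA.le
    rw [← mul_assoc, ← mul_assoc, hinv] at this
    linarith
  rw [← ENNReal.ofReal_toReal hEfin, ← ENNReal.ofReal_toReal hF, ← ENNReal.ofReal_mul hco.le]
  exact ENNReal.ofReal_le_ofReal hfinal
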